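/- Define V : ℝ → ℝ on the interval [0, ∑ i, d i] by V(q) = sSup {v | ∃ δ ∈ S(q), v = ∑ i, g i * δ i}. Then V is continuous on the closed interval [0, ∑ i, d i]. -/

import Mathlib

/-- A point of a box with coordinate sum `q` can be moved to a point of the box with coordinate
sum `q'` by changing each coordinate by at most `|q - q'|`. -/
theorem exists_mem_slice_abs_sub_le {ι : Type*} [Fintype ι] {d δ : ι → ℝ} {q q' : ℝ}
    (hδ : (∑ i, δ i = q) ∧ ∀ i, 0 ≤ δ i ∧ δ i ≤ d i) (hq' : q' ∈ Set.Icc 0 (∑ i, d i)) :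
    ∃ δ' : ι → ℝ, ((∑ i, δ' i = q') ∧ ∀ i, 0 ≤ δ' i ∧ δ' i ≤ d i) ∧
      ∀ i, |δ i - δ' i| ≤ |q - q'| := by
  obtain ⟨hsum, hbox⟩ := hδ
  obtain ⟨h0, hD⟩ := hq'
  rcases eq_or_ne q q' with rfl | hne
  · exact ⟨δ, ⟨hsum, hbox⟩, by simp⟩
  rcases lt_or_gt_of_ne hne with hlt | hgt
  · have hpos : 0 < (∑ i, d i) - q := by linarith
    obtain ⟨t, ht⟩ : ∃ t, t * ((∑ i, d i) - q) = q' - q := ⟨_, div_mul_cancel₀ _ hpos.ne'⟩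
    have ht0 : 0 ≤ t := by by_contra! h; nlinarith
    have ht1 : t ≤ 1 := by by_contra! h; nlinarith
    refine ⟨fun i => δ i + t * (d i - δ i), ⟨?_, fun i => ?_⟩, fun i => ?_⟩
    · rw [Finset.sum_add_distrib, ← Finset.mul_sum, Finset.sum_sub_distrib, hsum, ht]
      ring
    · obtain ⟨h1, h2⟩ := hbox i
      constructor <;> nlinarith
    · have hi : d i - δ i ≤ (∑ i, d i) - q := by
        rw [← hsum, ← Finset.sum_sub_distrib]
        exact Finset.single_le_sum (f := fun i => d i - δ i)
          (fun j _ => sub_nonneg.2 (hbox j).2) (Finset.mem_univ i)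
      rw [abs_sub_comm, abs_sub_comm q, add_sub_cancel_left, ← ht,
        abs_of_nonneg (mul_nonneg ht0 (sub_nonneg.2 (hbox i).2)),
        abs_of_nonneg (mul_nonneg ht0 hpos.le)]
      gcongr
  · have hpos : 0 < q := by linarith
    obtain ⟨t, ht⟩ : ∃ t, t * q = q - q' := ⟨_, div_mul_cancel₀ _ hpos.ne'⟩
    have ht0 : 0 ≤ t := by by_contra! h; nlinarith
    have ht1 : t ≤ 1 := by by_contra! h; nlinarith
    refine ⟨fun i => δ i - t * δ i, ⟨?_, fun i => ?_⟩, fun i => ?_⟩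
    · rw [Finset.sum_sub_distrib, ← Finset.mul_sum, hsum, ht]
      ring
    · obtain ⟨h1, h2⟩ := hbox i
      constructor <;> nlinarith
    · have hi : δ i ≤ q := by
        rw [← hsum]
        exact Finset.single_le_sum (fun j _ => (hbox j).1) (Finset.mem_univ i)
      rw [sub_sub_cancel, ← ht, abs_of_nonneg (mul_nonneg ht0 (hbox i).1),
        abs_of_nonneg (mul_nonneg ht0 hpos.le)]
      gcongr

/-- The value function `V(q) = sSup {∑ i, g i * δ i | δ ∈ S(q)}` of the continuous
bounded knapsack is continuous on the closed interval `[0, ∑ i, d i]`. -/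
theorem stmt_8 (n : ℕ) (d : Fin n → ℝ) (hd : ∀ i, 0 < d i) (g : Fin n → ℝ)
    (V : ℝ → ℝ)
    (hV : ∀ q ∈ Set.Icc (0 : ℝ) (∑ i, d i),
      V q = sSup {v : ℝ | ∃ δ : Fin n → ℝ,
        ((∑ i, δ i = q) ∧ ∀ i, 0 ≤ δ i ∧ δ i ≤ d i) ∧ v = ∑ i, g i * δ i}) :
    ContinuousOn V (Set.Icc (0 : ℝ) (∑ i, d i)) := by
  have hbdd : ∀ q, BddAbove {v : ℝ | ∃ δ : Fin n → ℝ,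
      ((∑ i, δ i = q) ∧ ∀ i, 0 ≤ δ i ∧ δ i ≤ d i) ∧ v = ∑ i, g i * δ i} := by
    refine fun q => ⟨∑ i, |g i| * d i, ?_⟩
    rintro v ⟨δ, ⟨-, hδ⟩, rfl⟩
    exact Finset.sum_le_sum fun i _ =>
      mul_le_mul (le_abs_self _) (hδ i).2 (hδ i).1 (abs_nonneg _)
  have hM : (0 : ℝ) ≤ ∑ i, |g i| := Finset.sum_nonneg fun i _ => abs_nonneg _
  refine (LipschitzOnWith.of_le_add_mul (NNReal.mk (∑ i, |g i|) hM)
    fun q hq q' hq' => ?_).continuousOn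
  rw [hV q hq, hV q' hq', NNReal.coe_mk, Real.dist_eq]
  apply csSup_le
  · obtain ⟨δ, hδ, -⟩ := exists_mem_slice_abs_sub_le (δ := fun _ : Fin n => (0 : ℝ)) (q := 0)
      ⟨by simp, fun i => ⟨le_rfl, (hd i).le⟩⟩ hq
    exact ⟨_, δ, hδ, rfl⟩
  · rintro v ⟨δ, hδ, rfl⟩
    obtain ⟨δ', hδ', hdiff⟩ := exists_mem_slice_abs_sub_le hδ hq'
    have hle : ∑ i, g i * δ i ≤ ∑ i, g i * δ' i + (∑ i, |g i|) * |q - q'| := by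
      rw [Finset.sum_mul, ← Finset.sum_add_distrib]
      refine Finset.sum_le_sum fun i _ => ?_
      have h := (le_abs_self (g i * (δ i - δ' i))).trans_eq (abs_mul _ _)
      have h' := mul_le_mul_of_nonneg_left (hdiff i) (abs_nonneg (g i))
      linarith
    exact hle.trans (by gcongr; exact le_csSup (hbdd q') ⟨δ', hδ', rfl⟩)
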